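/- If P, Q are sets of propositions and (M,X), (N,Y) are team models such that (M,X) ⇌_{P∩Q} (N,Y), then there exists a team model (K,Z) such that (M,X) ⇌_P (K,Z) and (K,Z) ⇌_Q (N,Y). -/

import Mathlib

/-- A Kripke model `M = (W, R, V)` over a set `V` of propositional letters. -/
structure KModel (V : Type) : Type 1 where
  W : Type
  R : W → W → Prop
  val : W → V → Prop

variable {V : Type}

/-- `B` is a `P`-bisimulation between the Kripke models `M` and `N`:
related points agree on all propositions of `P`, and `B` satisfies the
forth and back conditions. -/
def IsBisim (P : Set V) (M N : KModel V) (B : M.W → N.W → Prop) : Prop :=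
  (∀ w v, B w v → ∀ p ∈ P, (M.val w p ↔ N.val v p)) ∧
  (∀ w v, B w v → ∀ w', M.R w w' → ∃ v', N.R v v' ∧ B w' v') ∧
  (∀ w v, B w v → ∀ v', N.R v v' → ∃ w', M.R w w' ∧ B w' v')

/-- `(M,w) ⇌_P (N,v)`: some `P`-bisimulation relates `w` and `v`. -/
def Bisimilar (P : Set V) (M : KModel V) (w : M.W) (N : KModel V) (v : N.W) : Prop :=
  ∃ B, IsBisim P M N B ∧ B w v

/-- Team `P`-bisimulation `(M,X) ⇌_P (N,Y)`: every point of `X` is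
`P`-bisimilar to some point of `Y` and conversely. -/
def TeamBisim (P : Set V) (M : KModel V) (X : Set M.W) (N : KModel V) (Y : Set N.W) : Prop :=
  (∀ x ∈ X, ∃ y ∈ Y, Bisimilar P M x N y) ∧
  (∀ y ∈ Y, ∃ x ∈ X, Bisimilar P M x N y)

/-- The witnessing bisimulations can be chosen uniformly: `P`-bisimilarity is itself a
`P`-bisimulation. -/
theorem isBisim_bisimilar {V : Type} (P : Set V) (M N : KModel V) :
    IsBisim P M N (fun w v => Bisimilar P M w N v) := by
  refine ⟨?_, ?_, ?_⟩
  · rintro w v ⟨B, hB, hwv⟩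
    exact hB.1 w v hwv
  · rintro w v ⟨B, hB, hwv⟩ w' hw'
    obtain ⟨v', hv', h⟩ := hB.2.1 w v hwv w' hw'
    exact ⟨v', hv', B, hB, h⟩
  · rintro w v ⟨B, hB, hwv⟩ v' hv'
    obtain ⟨w', hw', h⟩ := hB.2.2 w v hwv v' hv'
    exact ⟨w', hw', B, hB, h⟩

/-- The amalgam of `M` and `N` along a relation `B`: its worlds are the `B`-related pairs,
with the valuation of `P` taken from `M` and that of `Q` taken from `N`. -/
def KModel.amalgam {V : Type} (P Q : Set V) (M N : KModel V) (B : M.W → N.W → Prop) :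
    KModel V where
  W := {z : M.W × N.W // B z.1 z.2}
  R z z' := M.R z.1.1 z'.1.1 ∧ N.R z.1.2 z'.1.2
  val z p := (p ∈ P ∧ M.val z.1.1 p) ∨ (p ∈ Q ∧ N.val z.1.2 p)

theorem IsBisim.amalgam_left {V : Type} {P Q : Set V} {M N : KModel V}
    {B : M.W → N.W → Prop} (hB : IsBisim (P ∩ Q) M N B) :
    IsBisim P M (KModel.amalgam P Q M N B) (fun w z => z.1.1 = w) := by
  refine ⟨?_, ?_, ?_⟩
  · rintro _ z rfl p hp
    have agree := hB.1 _ _ z.2 p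
    constructor
    · exact fun h => Or.inl ⟨hp, h⟩
    · rintro (⟨_, h⟩ | ⟨hq, h⟩)
      · exact h
      · exact (agree ⟨hp, hq⟩).2 h
  · rintro _ z rfl w' hw'
    obtain ⟨v', hv', h⟩ := hB.2.1 _ _ z.2 w' hw'
    exact ⟨⟨(w', v'), h⟩, ⟨hw', hv'⟩, rfl⟩
  · rintro _ z rfl z' hz'
    exact ⟨z'.1.1, hz'.1, rfl⟩

theorem IsBisim.amalgam_right {V : Type} {P Q : Set V} {M N : KModel V}
    {B : M.W → N.W → Prop} (hB : IsBisim (P ∩ Q) M N B) :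
    IsBisim Q (KModel.amalgam P Q M N B) N (fun z v => z.1.2 = v) := by
  refine ⟨?_, ?_, ?_⟩
  · rintro z _ rfl p hq
    have agree := hB.1 _ _ z.2 p
    constructor
    · rintro (⟨hp, h⟩ | ⟨_, h⟩)
      · exact (agree ⟨hp, hq⟩).1 h
      · exact h
    · exact fun h => Or.inr ⟨hq, h⟩
  · rintro z _ rfl z' hz'
    exact ⟨z'.1.2, hz'.2, rfl⟩
  · rintro z _ rfl v' hv'
    obtain ⟨w', hw', h⟩ := hB.2.2 _ _ z.2 v' hv'
    exact ⟨⟨(w', v'), h⟩, ⟨hw', hv'⟩, rfl⟩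

/-- team amalgamation: if `(M,X) ⇌_{P∩Q} (N,Y)` then there is
a team model `(K,Z)` with `(M,X) ⇌_P (K,Z)` and `(K,Z) ⇌_Q (N,Y)`. -/
theorem team_amalgamation {V : Type} (P Q : Set V)
    (M N : KModel V) (X : Set M.W) (Y : Set N.W)
    (h : TeamBisim (P ∩ Q) M X N Y) :
    ∃ (K : KModel V) (Z : Set K.W),
      TeamBisim P M X K Z ∧ TeamBisim Q K Z N Y := by
  have hB := isBisim_bisimilar (P ∩ Q) M N
  have hl := hB.amalgam_left
  have hr := hB.amalgam_right
  refine ⟨KModel.amalgam P Q M N (fun w v => Bisimilar (P ∩ Q) M w N v),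
    {z | z.1.1 ∈ X ∧ z.1.2 ∈ Y}, ⟨?_, ?_⟩, ⟨?_, ?_⟩⟩
  · intro x hx
    obtain ⟨y, hy, hxy⟩ := h.1 x hx
    exact ⟨⟨(x, y), hxy⟩, ⟨hx, hy⟩, _, hl, rfl⟩
  · intro z hz
    exact ⟨z.1.1, hz.1, _, hl, rfl⟩
  · intro z hz
    exact ⟨z.1.2, hz.2, _, hr, rfl⟩
  · intro y hy
    obtain ⟨x, hx, hxy⟩ := h.2 y hy
    exact ⟨⟨(x, y), hxy⟩, ⟨hx, hy⟩, _, hr, rfl⟩
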